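/- arXiv:2008.07398 — 3 statements merged into one kernel-verified Lean document; each statement's English description precedes it below -/
import Mathlib

section
/- Let 1 < p < ∞ and β ≥ 1. Then for every a, b, m ≥ 0: |a − b|^{p−2}(a − b)(a_m^β − b_m^β) ≥ (β p^p / (β + p − 1)^p) |a_m^{(β+p−1)/p} − b_m^{(β+p−1)/p}|^p, where a_m := min{a, m} and b_m := min{b, m}. -/
/-- Jensen's inequality for `t ↦ t ^ (s - 1)` on `[y, x]`, where `p * (s - 1) = β - 1`. -/
theorem mul_rpow_average_le_rpow_sub_rpow {p β s x y : ℝ} (hp : 1 ≤ p) (hβ : 1 ≤ β) (hs : 1 ≤ s)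
    (hsp : (s - 1) * p = β - 1) (hy : 0 ≤ y) (hyx : y < x) :
    β * (x - y) * ((x ^ s - y ^ s) / (s * (x - y))) ^ p ≤ x ^ β - y ^ β := by
  have hd : 0 < x - y := sub_pos.2 hyx
  have hs0 : 0 < s := by linarith
  have hβ0 : 0 < β := by linarith
  have hpow : 0 < x ^ s - y ^ s := sub_pos.2 (Real.rpow_lt_rpow hy hyx hs0)
  set A := (x ^ s - y ^ s) / (s * (x - y)) with hA
  have hA0 : 0 < A := by positivity
  have hint : ∀ r : ℝ, 1 ≤ r →
      IntervalIntegrable (fun t : ℝ => t ^ (r - 1)) MeasureTheory.volume y x :=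
    fun r hr => intervalIntegral.intervalIntegrable_rpow' (by linarith)
  have hval : ∀ r : ℝ, 1 ≤ r → ∫ t in y..x, t ^ (r - 1) = (x ^ r - y ^ r) / r := by
    intro r hr
    rw [integral_rpow (Or.inl (by linarith)), sub_add_cancel]
  have hpt : ∀ t ∈ Set.Icc y x,
      (1 - p) + p / A * t ^ (s - 1) ≤ (A ^ p)⁻¹ * t ^ (β - 1) := by
    intro t ht
    have ht0 : 0 ≤ t := hy.trans ht.1
    have h0 : 0 ≤ t ^ (s - 1) / A := by positivity
    have h := one_add_mul_self_le_rpow_one_add (s := t ^ (s - 1) / A - 1) (by linarith) hp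
    rw [add_sub_cancel, Real.div_rpow (by positivity) hA0.le, ← Real.rpow_mul ht0, hsp] at h
    calc (1 - p) + p / A * t ^ (s - 1) = 1 + p * (t ^ (s - 1) / A - 1) := by ring
      _ ≤ _ := h
      _ = _ := by ring
  have hmono := intervalIntegral.integral_mono_on hyx.le
    (intervalIntegrable_const.add ((hint s hs).const_mul (p / A)))
    ((hint β hβ).const_mul (A ^ p)⁻¹) hpt
  rw [intervalIntegral.integral_add intervalIntegrable_const ((hint s hs).const_mul (p / A)),
    intervalIntegral.integral_const_mul, intervalIntegral.integral_const_mul, hval s hs, hval β hβ,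
    intervalIntegral.integral_const, smul_eq_mul] at hmono
  have hAint : (x ^ s - y ^ s) / s = A * (x - y) := by
    rw [hA]; field_simp
  have hleft : (x - y) * (1 - p) + p / A * (A * (x - y)) = x - y := by
    field_simp; ring
  rw [hAint, hleft, ← div_eq_inv_mul, div_div, le_div_iff₀ (by positivity)] at hmono
  linarith

theorem rpow_sub_rpow_rpow_le {p β x y : ℝ} (hp : 1 < p) (hβ : 1 ≤ β) (hy : 0 ≤ y) (hyx : y ≤ x) :
    β * p ^ p / (β + p - 1) ^ p * (x ^ ((β + p - 1) / p) - y ^ ((β + p - 1) / p)) ^ p ≤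
      (x - y) ^ (p - 1) * (x ^ β - y ^ β) := by
  have hp0 : 0 < p := by linarith
  rcases hyx.eq_or_lt with rfl | hlt
  · simp [Real.zero_rpow hp0.ne']
  have hd : 0 < x - y := sub_pos.2 hlt
  have hq : 0 < β + p - 1 := by linarith
  set s := (β + p - 1) / p with hs
  have hs0 : 0 < s := by positivity
  have hs1 : 1 ≤ s := by rw [hs, le_div_iff₀ hp0]; linarith
  have hsp : (s - 1) * p = β - 1 := by rw [hs]; field_simp; ring
  have hpow : 0 ≤ x ^ s - y ^ s := sub_nonneg.2 (Real.rpow_le_rpow hy hyx hs0.le)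
  have h := mul_le_mul_of_nonneg_left
    (mul_rpow_average_le_rpow_sub_rpow hp.le hβ hs1 hsp hy hlt)
    (Real.rpow_nonneg hd.le (p - 1))
  refine le_trans (le_of_eq ?_) h
  have hdp : (x - y) ^ p = (x - y) ^ (p - 1) * (x - y) := by
    rw [← Real.rpow_add_one hd.ne', sub_add_cancel]
  have hsq : s ^ p = (β + p - 1) ^ p / p ^ p := Real.div_rpow hq.le hp0.le p
  rw [Real.div_rpow hpow (by positivity), Real.mul_rpow hs0.le hd.le, hdp, hsq]
  have : 0 < (x - y) ^ (p - 1) := by positivity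
  have : 0 < p ^ p := by positivity
  have : 0 < (β + p - 1) ^ p := by positivity
  field_simp

/-- Elementary inequality for truncated powers (Lemma C.2 of Brasco–Parini–Squassina). -/
theorem truncated_power_inequality
    {p β : ℝ} (hp1 : 1 < p) (hβ : 1 ≤ β)
    (a b m : ℝ) (ha : 0 ≤ a) (hb : 0 ≤ b) (hm : 0 ≤ m) :
    β * p ^ p / (β + p - 1) ^ p *
        |min a m ^ ((β + p - 1) / p) - min b m ^ ((β + p - 1) / p)| ^ p ≤
      |a - b| ^ (p - 2) * (a - b) * (min a m ^ β - min b m ^ β) := by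
  wlog hba : b ≤ a generalizing a b
  · have h := this b a hb ha (le_of_not_ge hba)
    rw [abs_sub_comm, abs_sub_comm a b]
    linarith
  have hp0 : 0 < p := by linarith
  rcases hba.eq_or_lt with rfl | hlt
  · simp [Real.zero_rpow hp0.ne']
  have hd : 0 < a - b := sub_pos.2 hlt
  have hy : 0 ≤ min b m := le_min hb hm
  have hyx : min b m ≤ min a m := min_le_min_right m hba
  have hle : min a m - min b m ≤ a - b := by
    rcases min_cases a m with h | h <;> rcases min_cases b m with h' | h' <;> linarith
  have hexp : 0 ≤ (β + p - 1) / p := div_nonneg (by linarith) hp0.le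
  have hsign : |a - b| ^ (p - 2) * (a - b) = (a - b) ^ (p - 1) := by
    rw [abs_of_pos hd, ← Real.rpow_add_one hd.ne']
    congr 1
    ring
  rw [hsign, abs_of_nonneg (sub_nonneg.2 (Real.rpow_le_rpow hy hyx hexp))]
  refine (rpow_sub_rpow_rpow_le hp1 hβ hy hyx).trans ?_
  exact mul_le_mul_of_nonneg_right
    (Real.rpow_le_rpow (sub_nonneg.2 hyx) hle (by linarith))
    (sub_nonneg.2 (Real.rpow_le_rpow hy hyx (by linarith)))
end

section
/- Let 1 < p < ∞ and let f : ℝ → ℝ be a convex differentiable function. Then for every a, b ∈ ℝ and every A, B ≥ 0: |a − b|^{p−2}(a − b) [ A |f'(a)|^{p−2} f'(a) − B |f'(b)|^{p−2} f'(b) ] ≥ |f(a) − f(b)|^{p−2} (f(a) − f(b)) (A − B). -/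
/-- The signed power `t ↦ |t| ^ (p - 2) * t` is monotone for `1 < p`. -/
theorem monotone_abs_rpow_mul_self {p : ℝ} (hp : 1 < p) :
    Monotone fun t : ℝ => |t| ^ (p - 2) * t := by
  have key : ∀ t : ℝ, 0 ≤ t → |t| ^ (p - 2) * t = t ^ (p - 1) := by
    intro t ht
    rcases ht.eq_or_lt with rfl | ht
    · rw [Real.zero_rpow (by linarith), mul_zero]
    · rw [abs_of_pos ht, show p - 1 = p - 2 + 1 by ring, Real.rpow_add_one ht.ne']
  have mono : ∀ s t : ℝ, 0 ≤ s → s ≤ t → |s| ^ (p - 2) * s ≤ |t| ^ (p - 2) * t := by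
    intro s t hs hst
    rw [key s hs, key t (hs.trans hst)]
    exact Real.rpow_le_rpow hs hst (by linarith)
  intro s t hst
  rcases le_total 0 s with hs | hs
  · exact mono s t hs hst
  rcases le_total 0 t with ht | ht
  · exact (mul_nonpos_of_nonneg_of_nonpos (by positivity) hs).trans (by positivity)
  · have h := mono (-t) (-s) (by linarith) (by linarith)
    simp only [abs_neg, mul_neg] at h
    exact neg_le_neg_iff.mp h

theorem abs_rpow_mul_self_mul (r s t : ℝ) :
    |s * t| ^ r * (s * t) = |s| ^ r * s * (|t| ^ r * t) := by
  rw [abs_mul, Real.mul_rpow (abs_nonneg s) (abs_nonneg t)]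
  ring

/-- A differentiable convex function lies above its tangent lines. -/
theorem ConvexOn.sub_le_sub_mul_deriv {f : ℝ → ℝ} (hconv : ConvexOn ℝ Set.univ f)
    {x : ℝ} (hdiff : DifferentiableAt ℝ f x) (y : ℝ) :
    f x - f y ≤ (x - y) * deriv f x := by
  rcases lt_trichotomy x y with h | rfl | h
  · have := hconv.deriv_le_slope (Set.mem_univ x) (Set.mem_univ y) h hdiff
    rw [slope_def_field, le_div_iff₀ (sub_pos.mpr h)] at this
    linarith
  · simp
  · have := hconv.slope_le_deriv (Set.mem_univ y) (Set.mem_univ x) h hdiff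
    rw [slope_def_field, div_le_iff₀ (sub_pos.mpr h)] at this
    linarith

/-- Elementary inequality for convex functions (Lemma A.1 of Brasco–Parini). -/
theorem convex_power_inequality
    {p : ℝ} (hp : 1 < p) (f : ℝ → ℝ)
    (hconv : ConvexOn ℝ Set.univ f) (hdiff : Differentiable ℝ f)
    (a b A B : ℝ) (hA : 0 ≤ A) (hB : 0 ≤ B) :
    |f a - f b| ^ (p - 2) * (f a - f b) * (A - B) ≤
      |a - b| ^ (p - 2) * (a - b) *
        (A * (|deriv f a| ^ (p - 2) * deriv f a) - B * (|deriv f b| ^ (p - 2) * deriv f b)) := by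
  have ha := monotone_abs_rpow_mul_self hp (hconv.sub_le_sub_mul_deriv (hdiff a) b)
  have hb' : (a - b) * deriv f b ≤ f a - f b := by
    linarith [hconv.sub_le_sub_mul_deriv (hdiff b) a]
  have hb := monotone_abs_rpow_mul_self hp hb'
  simp only [abs_rpow_mul_self_mul] at ha hb
  linarith [mul_le_mul_of_nonneg_left ha hA, mul_le_mul_of_nonneg_left hb hB]
end

section
/- Let p ≥ 2. Then for all a, b ∈ ℝ: |a⁺ − b⁺|^p ≤ |a − b|^{p−2}(a − b)(a⁺ − b⁺), where t⁺ := max{t, 0}. -/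
/-- The positive part is firmly nonexpansive. -/
theorem sq_posPart_sub_le (a b : ℝ) :
    (max a 0 - max b 0) ^ 2 ≤ (a - b) * (max a 0 - max b 0) := by
  rcases max_cases a 0 with ⟨ha, _⟩ | ⟨ha, _⟩ <;>
    rcases max_cases b 0 with ⟨hb, _⟩ | ⟨hb, _⟩ <;> rw [ha, hb] <;> nlinarith

/-- For `p ≥ 2`: `|a⁺ − b⁺|^p ≤ |a − b|^{p−2}(a − b)(a⁺ − b⁺)`. -/
theorem positive_part_power_inequality
    {p : ℝ} (hp : 2 ≤ p) (a b : ℝ) :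
    |max a 0 - max b 0| ^ p ≤ |a - b| ^ (p - 2) * (a - b) * (max a 0 - max b 0) := by
  have hp' : 0 ≤ p - 2 := sub_nonneg.mpr hp
  calc |max a 0 - max b 0| ^ p
      = |max a 0 - max b 0| ^ (p - 2) * (max a 0 - max b 0) ^ 2 := by
        rw [← sq_abs (max a 0 - max b 0), ← Real.rpow_two,
          ← Real.rpow_add_of_nonneg (abs_nonneg _) hp' zero_le_two, sub_add_cancel]
    _ ≤ |a - b| ^ (p - 2) * ((a - b) * (max a 0 - max b 0)) :=
        mul_le_mul (Real.rpow_le_rpow (abs_nonneg _) (abs_max_sub_max_le_abs a b 0) hp')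
          (sq_posPart_sub_le a b) (sq_nonneg _) (Real.rpow_nonneg (abs_nonneg _) _)
    _ = |a - b| ^ (p - 2) * (a - b) * (max a 0 - max b 0) := (mul_assoc _ _ _).symm
end
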